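/- Fix m, b₀, v, s, η, λ and r₁, …, r_m with r = ∑_{i} r_i. For each i : Fin m, let G i be a finite additive abelian group with b₀ elements, let M i : Matrix (G i) (Fin v) ℕ be a (0,1)-matrix whose every column sums to r_i, and assume that for all distinct p ≠ q, ∑_{i} ∑_{x : G i} (M i) x p * (M i) x q = λ (so the m matrices together form a partition of the incidence matrix of an (r, λ)-design into m parts of b₀ blocks each, the i-th part having constant replication r_i). For each i, let D i : Fin (η * b₀) → Fin s → G i be a (b₀, s; η)-difference matrix over G i. Define X : Matrix (Σ i : Fin m, Fin (η * b₀) × G i) (Fin s × Fin v) ℕ by X ⟨i, k, x⟩ (j, p) = (M i) (x + D i k j) p. Then: (Xᵀ * X) ((j,p), (j,p)) = η * b₀ * r for all j, p; (Xᵀ * X) ((j,p), (j,q)) = η * b₀ * λ for all j and all p ≠ q; and (Xᵀ * X) ((j,p), (j',q)) = η * ∑_i (r_i)^2 for all j ≠ j' and all p, q. -/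

import Mathlib

open Matrix

/-- If every fibre of `d` has `n` elements, summing `f ∘ d` is `n` times summing `f`. -/
theorem sum_comp_of_card_fiber_eq {ι α : Type*} [Fintype ι] [Fintype α] [DecidableEq α]
    (d : ι → α) (n : ℕ) (hd : ∀ a, (Finset.univ.filter (fun k => d k = a)).card = n)
    (f : α → ℕ) : ∑ k, f (d k) = n * ∑ a, f a := by
  rw [← Finset.sum_fiberwise Finset.univ d, Finset.mul_sum]
  refine Finset.sum_congr rfl fun a _ => ?_
  rw [Finset.sum_congr rfl (g := fun _ => f a) fun k hk => by rw [(Finset.mem_filter.mp hk).2],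
    Finset.sum_const, hd, smul_eq_mul]

/-- The total correlation of two functions over all shifts is the product of their sums. -/
theorem sum_sum_add_mul {A : Type*} [AddCommGroup A] [Fintype A] (f h : A → ℕ) :
    ∑ g, ∑ y, f (y + g) * h y = (∑ x, f x) * ∑ y, h y := by
  rw [Finset.sum_comm, Finset.mul_sum]
  refine Finset.sum_congr rfl fun y _ => ?_
  rw [← Finset.sum_mul, ← Equiv.sum_comp (Equiv.addLeft y) f]
  simp only [Equiv.coe_addLeft]

/-- Correlating translates of `f` and `h` along two columns of a difference matrix. -/
theorem sum_sum_add_mul_add_of_card_sub_eq {ι A : Type*} [Fintype ι] [AddCommGroup A] [Fintype A]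
    [DecidableEq A] (a c : ι → A) (n : ℕ)
    (hd : ∀ g, (Finset.univ.filter (fun k => a k - c k = g)).card = n) (f h : A → ℕ) :
    ∑ k, ∑ x, f (x + a k) * h (x + c k) = n * ((∑ x, f x) * ∑ y, h y) := by
  rw [← sum_sum_add_mul,
    ← sum_comp_of_card_fiber_eq (fun k => a k - c k) n hd (fun g => ∑ y, f (y + g) * h y)]
  refine Finset.sum_congr rfl fun k _ => ?_
  rw [← Equiv.sum_comp (Equiv.addRight (c k)) fun y => f (y + (a k - c k)) * h y]
  refine Finset.sum_congr rfl fun x _ => ?_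
  simp only [Equiv.coe_addRight, add_assoc, add_sub_cancel]

/-- Decomposition method: pasting tile matrices of the parts of a partitioned (r,λ)-design
onto difference matrices yields a GDD-type SBBD with
Λ = (η b₀ r, η b₀ λ, η ∑ rᵢ², η ∑ rᵢ²). -/
theorem stmt1 (m b₀ v s η lam : ℕ) (rvec : Fin m → ℕ) (r : ℕ) (hr : r = ∑ i, rvec i)
    (G : Fin m → Type) [∀ i, AddCommGroup (G i)] [∀ i, Fintype (G i)] [∀ i, DecidableEq (G i)]
    (hb : ∀ i, Fintype.card (G i) = b₀)
    (M : ∀ i, Matrix (G i) (Fin v) ℕ)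
    (hM01 : ∀ i x p, M i x p = 0 ∨ M i x p = 1)
    (hMr : ∀ i p, ∑ x, M i x p = rvec i)
    (hMlam : ∀ p q, p ≠ q → ∑ i, ∑ x, M i x p * M i x q = lam)
    (D : ∀ i, Fin (η * b₀) → Fin s → G i)
    (hD : ∀ i j j', j ≠ j' → ∀ g : G i,
      (Finset.univ.filter (fun k => D i k j - D i k j' = g)).card = η)
    (X : Matrix (Σ i : Fin m, Fin (η * b₀) × G i) (Fin s × Fin v) ℕ)
    (hX : ∀ i k x j p, X ⟨i, (k, x)⟩ (j, p) = M i (x + D i k j) p) :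
    (∀ j p, (Xᵀ * X) (j, p) (j, p) = η * b₀ * r) ∧
    (∀ j p q, p ≠ q → (Xᵀ * X) (j, p) (j, q) = η * b₀ * lam) ∧
    (∀ j j' p q, j ≠ j' → (Xᵀ * X) (j, p) (j', q) = η * ∑ i, rvec i ^ 2) := by
  have entry (j j' p q) : (Xᵀ * X) (j, p) (j', q) =
      ∑ i, ∑ k, ∑ x, M i (x + D i k j) p * M i (x + D i k j') q := by
    simp only [mul_apply, transpose_apply, Fintype.sum_sigma, Fintype.sum_prod_type, hX]
  have same_block (j p q) : (Xᵀ * X) (j, p) (j, q) =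
      η * b₀ * ∑ i, ∑ x, M i x p * M i x q := by
    rw [entry, Finset.mul_sum]
    refine Finset.sum_congr rfl fun i _ => ?_
    have shift (k) : ∑ x, M i (x + D i k j) p * M i (x + D i k j) q =
        ∑ x, M i x p * M i x q :=
      Equiv.sum_comp (Equiv.addRight (D i k j)) fun x => M i x p * M i x q
    simp [shift]
  refine ⟨fun j p => ?_, fun j p q hpq => ?_, fun j j' p q hj => ?_⟩
  · rw [same_block, hr]
    congr 1
    refine Finset.sum_congr rfl fun i _ => ?_
    rw [← hMr i p]
    refine Finset.sum_congr rfl fun x _ => ?_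
    rcases hM01 i x p with h | h <;> simp [h]
  · rw [same_block, hMlam p q hpq]
  · rw [entry, Finset.mul_sum]
    refine Finset.sum_congr rfl fun i _ => ?_
    rw [sum_sum_add_mul_add_of_card_sub_eq (fun k => D i k j) (fun k => D i k j') η
      (hD i j j' hj) (fun x => M i x p) (fun x => M i x q), hMr, hMr, sq]
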